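/- Let f be a function on an open set N ⊆ Ω that is twice differentiable at Σ ∈ N. Then for every domain A ⊃ γ(Σ) and all holomorphic vector fields h, h' ∈ H^>(A): ∇_h ∇_{h'} f(Σ) − ∇_{h'} ∇_h f(Σ) = ∇_{h∂h' − h'∂h} f(Σ). -/

import Mathlib

open Set Filter Topology

noncomputable section

attribute [local instance] Classical.propDecidable

/-- The Riemann sphere, modelled as the one-point compactification of `ℂ`. -/
abbrev RS := OnePoint ℂ

namespace CFT

/-- Read a point of the sphere in the standard (finite) coordinate; `∞ ↦ 0` (junk). -/
def toC (p : RS) : ℂ := Option.rec 0 id (show Option ℂ from p)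

/-- The chart at infinity: `z ↦ 1/z`, with `0 ↦ ∞`. -/
def fromInvChart (z : ℂ) : RS := if z = 0 then OnePoint.infty else ((z⁻¹ : ℂ) : RS)

/-- Read a point of the sphere in the coordinate at infinity. -/
def toInvChart (q : RS) : ℂ := if q = OnePoint.infty then 0 else (toC q)⁻¹

/-- Holomorphy of a sphere map at a point, read in the standard charts. -/
def SphHolAt (f : RS → RS) (p : RS) : Prop :=
  ContinuousAt f p ∧
  AnalyticAt ℂ
    (fun z : ℂ =>
      (if f p = OnePoint.infty then toInvChart else toC)
        (f (if p = OnePoint.infty then fromInvChart z else ((z : ℂ) : RS))))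
    (if p = OnePoint.infty then 0 else toC p)

/-- A conformal map: a holomorphic injection defined on a domain of the Riemann sphere. -/
structure ConfMap where
  dom : Set RS
  toFun : RS → RS
  isOpen_dom : IsOpen dom
  nonempty_dom : dom.Nonempty
  dom_ne_univ : dom ≠ univ
  holo : ∀ p ∈ dom, SphHolAt toFun p
  injOn : InjOn toFun dom

/-- A domain: a nonempty open proper subset of the Riemann sphere. -/
def IsDomain (A : Set RS) : Prop := IsOpen A ∧ A.Nonempty ∧ A ≠ univ

/-- The round (chordal) metric on the sphere, normalized so that `d(0,∞) = 1`. -/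
def chord (p q : RS) : ℝ :=
  Option.rec
    (Option.rec 0 (fun w => 1 / Real.sqrt (1 + ‖w‖ ^ 2)) (show Option ℂ from q))
    (fun z =>
      Option.rec (1 / Real.sqrt (1 + ‖z‖ ^ 2))
        (fun w => ‖z - w‖ / (Real.sqrt (1 + ‖z‖ ^ 2) * Real.sqrt (1 + ‖w‖ ^ 2)))
        (show Option ℂ from q))
    (show Option ℂ from p)

/-- The connected component of `0` in the complement of `S`. -/
def intComp (S : Set RS) : Set RS := connectedComponentIn Sᶜ ((0 : ℂ) : RS)

/-- The connected component of `∞` in the complement of `S`. -/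
def extComp (S : Set RS) : Set RS := connectedComponentIn Sᶜ OnePoint.infty

/-- `α(Σ)`: the set together with the component of its complement containing `0`. -/
def alphaSetOf (S : Set RS) : Set RS := S ∪ intComp S

/-- `β(Σ)`: the set together with the component of its complement containing `∞`. -/
def betaSetOf (S : Set RS) : Set RS := S ∪ extComp S

/-- Sense-preservation of a conformal map relative to an annular continuum `S`. -/
def SensePreserving (g : ConfMap) (S : Set RS) : Prop :=
  ((0 : ℂ) : RS) ∉ g.toFun '' S ∧ OnePoint.infty ∉ g.toFun '' S ∧
  intComp (g.toFun '' S) ≠ extComp (g.toFun '' S) ∧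
  g.toFun '' (g.dom ∩ intComp S) ⊆ intComp (g.toFun '' S) ∧
  g.toFun '' (g.dom ∩ extComp S) ⊆ extComp (g.toFun '' S)

/-- An annular continuum separating `0` from `∞`, with both complementary components
simply connected. -/
structure IsAnnular (S : Set RS) : Prop where
  compact : IsCompact S
  connected : IsConnected S
  zero_not_mem : ((0 : ℂ) : RS) ∉ S
  infty_not_mem : OnePoint.infty ∉ S
  comps : ∀ p ∉ S, connectedComponentIn Sᶜ p = intComp S ∨ connectedComponentIn Sᶜ p = extComp S
  comps_ne : intComp S ≠ extComp S
  simply_int : SimplyConnectedSpace ↥(intComp S)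
  simply_ext : SimplyConnectedSpace ↥(extComp S)

/-- `g` is defined and sense-preserving on `S` (so it "has an action" there). -/
def HasActionOn (g : ConfMap) (S : Set RS) : Prop := S ⊆ g.dom ∧ SensePreserving g S

/-- An exhaustion of a domain by an increasing sequence of compact sets. -/
structure Exhaustion (A : Set RS) where
  D : ℕ → Set RS
  isCompact : ∀ n, IsCompact (D n)
  mono : Monotone D
  iUnion_eq : (⋃ n, D n) = A

/-- The functional `δ_A(g)` measuring distance of a conformal map from the identity,
relative to an exhaustion of `A`. -/
def deltaA {A : Set RS} (e : Exhaustion A) (g : ConfMap) : ℝ :=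
  ∑' n : ℕ, (2 : ℝ)⁻¹ ^ (n + 1) *
    (if e.D n ⊆ g.dom then sSup ((fun z => chord (g.toFun z) z) '' e.D n) else 1)

/-- A global choice of exhaustions, one for each domain. -/
abbrev ExhChoice := ∀ A : Set RS, IsDomain A → Exhaustion A

/-- The set of complex points of `A`, in the global coordinate. -/
def finitePart (A : Set RS) : Set ℂ := {z : ℂ | (z : RS) ∈ A}

/-- Holomorphic vector fields on a domain `A`, written in the global coordinate
(with the order-two condition at `∞` when `∞ ∈ A`). -/
def HVFset (A : Set RS) : Set (ℂ → ℂ) :=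
  {h | DifferentiableOn ℂ h (finitePart A) ∧
    (OnePoint.infty ∈ A → ∃ H : ℂ → ℂ, AnalyticAt ℂ H 0 ∧
      ∀ᶠ w in 𝓝[≠] (0 : ℂ), H w = w ^ 2 * h w⁻¹)}

/-- Compact convergence (in local coordinates) of vector fields on a domain `A`. -/
def HVFTendsto {ι : Type*} (A : Set RS) (l : Filter ι) (hs : ι → ℂ → ℂ) (h : ℂ → ℂ) : Prop :=
  TendstoLocallyUniformlyOn hs h l (finitePart A) ∧
  (OnePoint.infty ∈ A →
    TendstoLocallyUniformlyOn (fun i w => w ^ 2 * hs i w⁻¹) (fun w => w ^ 2 * h w⁻¹) l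
      {w : ℂ | w ≠ 0 ∧ ((w⁻¹ : ℂ) : RS) ∈ A})

/-- The vector fields `h_{n;w}(z) = (w-z)^{n+1}`. -/
def hvf (n : ℤ) (w : ℂ) : ℂ → ℂ := fun z => (w - z) ^ (n + 1)

/-- A conformal map read in the global coordinate. -/
def mapC (g : ConfMap) : ℂ → ℂ := fun z => toC (g.toFun (z : RS))

/-- The derivative `∂g(w)` of a conformal map at a finite point. -/
def dg (g : ConfMap) (w : ℂ) : ℂ := deriv (mapC g) w

/-- The Schwarzian derivative `{g, w}`. -/
def schwarzian (g : ConfMap) (w : ℂ) : ℂ :=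
  iteratedDeriv 3 (mapC g) w / deriv (mapC g) w -
    (3 / 2) * (iteratedDeriv 2 (mapC g) w / deriv (mapC g) w) ^ 2

/-- Joint continuity and real multilinearity of a functional on `k`-tuples of holomorphic
vector fields on `A` (continuity in the compact convergence topology). -/
def IsContMultilinear (A : Set RS) (k : ℕ) (L : (Fin k → ℂ → ℂ) → ℂ) : Prop :=
  (∀ (v : Fin k → ℂ → ℂ) (j : Fin k) (h' : ℂ → ℂ), (∀ i, v i ∈ HVFset A) → h' ∈ HVFset A →
    L (Function.update v j (v j + h')) = L v + L (Function.update v j h')) ∧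
  (∀ (v : Fin k → ℂ → ℂ) (j : Fin k) (c : ℝ), (∀ i, v i ∈ HVFset A) →
    L (Function.update v j (c • v j)) = c • L v) ∧
  (∀ (vs : ℕ → Fin k → ℂ → ℂ) (v : Fin k → ℂ → ℂ),
    (∀ n i, vs n i ∈ HVFset A) → (∀ i, v i ∈ HVFset A) →
    (∀ i, HVFTendsto A atTop (fun n => vs n i) (v i)) →
    Tendsto (fun n => L (vs n)) atTop (𝓝 (L v)))

/-- Admissible `k`-parameter families of conformal maps tending to the identity
in the `A`-topology, with directions `h j` (the set `F^k(A)` of the paper). -/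
def FamilyOK (X : ExhChoice) {A : Set RS} (hA : IsDomain A) {k : ℕ}
    (g : (Fin k → ℝ) → Fin k → ConfMap) (h : Fin k → ℂ → ℂ) : Prop :=
  (∀ j, Tendsto (fun t => deltaA (X A hA) (g t j)) (𝓝 0) (𝓝 0)) ∧
  (∀ j, TendstoLocallyUniformlyOn
      (fun (t : Fin k → ℝ) (z : ℂ) => (t j)⁻¹ • (toC ((g t j).toFun (z : RS)) - z)) (h j)
      (𝓝[{t | t j ≠ 0}] 0) (finitePart A))

section OmegaSection

variable (E : Set RS)

/-- The space `Ω`: restrictions to `E` of sense-preserving conformal maps defined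
on neighbourhoods of `E` (two maps being identified when they agree on `E`). -/
def OmegaS : Set (E → RS) :=
  {φ | ∃ g : ConfMap, E ⊆ g.dom ∧ SensePreserving g E ∧ ∀ x : E, φ x = g.toFun ↑x}

/-- Action of a conformal map on an element of `Ω`: `g·Σ := g ∘ Σ`. -/
def actF (g : ConfMap) (φ : E → RS) : E → RS := fun x => g.toFun (φ x)

/-- Open sets of the conformal topology on `Ω`. -/
def ConfOpen (X : ExhChoice) (N : Set (E → RS)) : Prop :=
  N ⊆ OmegaS E ∧
  ∀ φ ∈ N, ∀ A : Set RS, ∀ hA : IsDomain A, range φ ⊆ A →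
    ∃ r : ℝ, 0 < r ∧ r < 1 ∧ ∀ g : ConfMap, deltaA (X A hA) g < r → actF E g φ ∈ N

/-- An α-map at `Σ`: a sense-preserving conformal map on a simply connected domain
containing `α(Σ)`, having an action on `Σ`. -/
def IsAlphaMap (g : ConfMap) (φ : E → RS) : Prop :=
  IsDomain g.dom ∧ SimplyConnectedSpace ↥g.dom ∧ alphaSetOf (range φ) ⊆ g.dom ∧
  HasActionOn g (range φ)

/-- A β-map at `Σ`. -/
def IsBetaMap (g : ConfMap) (φ : E → RS) : Prop :=
  IsDomain g.dom ∧ SimplyConnectedSpace ↥g.dom ∧ betaSetOf (range φ) ⊆ g.dom ∧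
  HasActionOn g (range φ)

/-- Continuity at a point of a map into `Ω`, with respect to the conformal topology. -/
def ContinuousAtOmega (X : ExhChoice) {M : Type*} [TopologicalSpace M]
    (σ : M → E → RS) (p : M) : Prop :=
  ∀ N : Set (E → RS), ConfOpen E X N → σ p ∈ N → ∀ᶠ t in 𝓝 p, σ t ∈ N

/-- The data for differentiability of a path at `p`: the maps `G t = Σ_t ∘ Σ_p⁻¹`
converge to the identity in the `A`-topology and the difference quotients converge
compactly on `A` to the direction `h`. -/
def DiffQuotOK (X : ExhChoice) (A : Set RS) (hA : IsDomain A) (σ : ℝ → E → RS) (p : ℝ)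
    (G : ℝ → ConfMap) (h : ℂ → ℂ) : Prop :=
  (∀ t, ∀ x : E, (G t).toFun (σ p x) = σ t x) ∧
  Tendsto (fun t => deltaA (X A hA) (G t)) (𝓝 p) (𝓝 0) ∧
  TendstoLocallyUniformlyOn
    (fun t (z : ℂ) => (t - p)⁻¹ • (toC ((G t).toFun (z : RS)) - z)) h
    (𝓝[≠] p) (finitePart A)

/-- Differentiability of a path in `Ω` at `p`, with direction `h ∈ H^>(A)`. -/
def PathDiffAt (X : ExhChoice) (σ : ℝ → E → RS) (p : ℝ) (A : Set RS) (hA : IsDomain A)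
    (h : ℂ → ℂ) : Prop :=
  ContinuousAtOmega E X σ p ∧ range (σ p) ⊆ A ∧ h ∈ HVFset A ∧
  ∃ G : ℝ → ConfMap, DiffQuotOK E X A hA σ p G h

/-- The data of a smooth path on `[u,v]`: differentiable at every point with
continuously varying direction `Dir`. -/
def SmoothPathData (X : ExhChoice) (σ : ℝ → E → RS) (u v : ℝ) (B : Set RS) (hB : IsDomain B)
    (Dir : ℝ → ℂ → ℂ) : Prop :=
  (∀ t ∈ Icc u v, PathDiffAt E X σ t B hB (Dir t)) ∧
  (∀ t ∈ Icc u v, HVFTendsto B (𝓝 t) Dir (Dir t))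

/-- A smooth path on `[u,v]`. -/
def IsSmoothPathOn (X : ExhChoice) (σ : ℝ → E → RS) (u v : ℝ) : Prop :=
  ∃ B hB Dir, SmoothPathData E X σ u v B hB Dir

/-- A smooth α-path. -/
def IsSmoothAlphaPathOn (X : ExhChoice) (σ : ℝ → E → RS) (u v : ℝ) : Prop :=
  ∃ B hB Dir, SmoothPathData E X σ u v B hB Dir ∧
    ∀ t ∈ Icc u v, alphaSetOf (range (σ t)) ⊆ B

/-- A smooth β-path. -/
def IsSmoothBetaPathOn (X : ExhChoice) (σ : ℝ → E → RS) (u v : ℝ) : Prop :=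
  ∃ B hB Dir, SmoothPathData E X σ u v B hB Dir ∧
    ∀ t ∈ Icc u v, betaSetOf (range (σ t)) ⊆ B

/-- A piecewise smooth path on `[u,v]` (a finite concatenation of smooth paths). -/
def IsPiecewiseSmoothPathOn (X : ExhChoice) (σ : ℝ → E → RS) (u v : ℝ) : Prop :=
  ∃ (n : ℕ) (ts : ℕ → ℝ), ts 0 = u ∧ ts n = v ∧ (∀ i < n, ts i ≤ ts (i + 1)) ∧
    ∀ i < n, IsSmoothPathOn E X σ (ts i) (ts (i + 1))

/-- A piecewise smooth α-path. -/
def IsPiecewiseSmoothAlphaPathOn (X : ExhChoice) (σ : ℝ → E → RS) (u v : ℝ) : Prop :=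
  ∃ (n : ℕ) (ts : ℕ → ℝ), ts 0 = u ∧ ts n = v ∧ (∀ i < n, ts i ≤ ts (i + 1)) ∧
    ∀ i < n, IsSmoothAlphaPathOn E X σ (ts i) (ts (i + 1))

/-- A piecewise smooth β-path. -/
def IsPiecewiseSmoothBetaPathOn (X : ExhChoice) (σ : ℝ → E → RS) (u v : ℝ) : Prop :=
  ∃ (n : ℕ) (ts : ℕ → ℝ), ts 0 = u ∧ ts n = v ∧ (∀ i < n, ts i ≤ ts (i + 1)) ∧
    ∀ i < n, IsSmoothBetaPathOn E X σ (ts i) (ts (i + 1))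

/-- Piecewise α-smooth connectedness of a subset of `Ω`. -/
def PiecewiseAlphaConnected (X : ExhChoice) (N : Set (E → RS)) : Prop :=
  ∀ φ ∈ N, ∀ g : ConfMap, IsAlphaMap E g φ → actF E g φ ∈ N →
    ∃ σ : ℝ → E → RS, σ 0 = φ ∧ σ 1 = actF E g φ ∧ (∀ t ∈ Icc (0 : ℝ) 1, σ t ∈ N) ∧
      IsPiecewiseSmoothAlphaPathOn E X σ 0 1

/-- Piecewise β-smooth connectedness of a subset of `Ω`. -/
def PiecewiseBetaConnected (X : ExhChoice) (N : Set (E → RS)) : Prop :=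
  ∀ φ ∈ N, ∀ g : ConfMap, IsBetaMap E g φ → actF E g φ ∈ N →
    ∃ σ : ℝ → E → RS, σ 0 = φ ∧ σ 1 = actF E g φ ∧ (∀ t ∈ Icc (0 : ℝ) 1, σ t ∈ N) ∧
      IsPiecewiseSmoothBetaPathOn E X σ 0 1

/-- Piecewise smooth connectedness of a subset of `Ω`. -/
def PiecewiseSmoothlyConnected (X : ExhChoice) (N : Set (E → RS)) : Prop :=
  ∀ φ ∈ N, ∀ ψ ∈ N,
    ∃ σ : ℝ → E → RS, σ 0 = φ ∧ σ 1 = ψ ∧ (∀ t ∈ Icc (0 : ℝ) 1, σ t ∈ N) ∧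
      IsPiecewiseSmoothPathOn E X σ 0 1

/-- `g_S · Σ`: composition of the family maps over the subset `S` (increasing indices
outermost first, i.e. `g_S = g^{(j₁)} ∘ ⋯ ∘ g^{(j_{|S|})}` with `j₁ < ⋯ < j_{|S|}`). -/
def applyFam {k : ℕ} (g : (Fin k → ℝ) → Fin k → ConfMap) (t : Fin k → ℝ) (S : Finset (Fin k))
    (φ : E → RS) : E → RS :=
  fun x => (S.sort (· ≤ ·)).foldr (fun j q => (g t j).toFun q) (φ x)

/-- `f` has `k`-th `A`-differential `L` at `Σ`: the alternating-sum multi-difference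
limits exist along all admissible families and are given by the continuous real
multilinear functional `L` (the direction of `g^{(j)}` sits in slot `j`,
slot `0` being the innermost derivative). -/
def HasKDeriv (X : ExhChoice) (f : (E → RS) → ℂ) (φ : E → RS) (A : Set RS) (hA : IsDomain A)
    (k : ℕ) (L : (Fin k → ℂ → ℂ) → ℂ) : Prop :=
  IsContMultilinear A k L ∧
  ∀ (g : (Fin k → ℝ) → Fin k → ConfMap) (h : Fin k → ℂ → ℂ),
    (∀ j, h j ∈ HVFset A) → FamilyOK X hA g h →
    Tendsto (fun t : Fin k → ℝ =>
        (∏ j, t j)⁻¹ • ∑ S : Finset (Fin k), (-1 : ℂ) ^ (k - S.card) * f (applyFam E g t S φ))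
      (𝓝[{t | ∀ j, t j ≠ 0}] 0) (𝓝 (L h))

/-- `k` times `A`-differentiability at `Σ` (with the recursive neighbourhood condition). -/
def KDiffAtA (X : ExhChoice) (f : (E → RS) → ℂ) :
    ℕ → (E → RS) → ∀ A : Set RS, IsDomain A → Prop
  | 0, _, _, _ => True
  | (k + 1), φ, A, hA =>
      (∃ L, HasKDeriv E X f φ A hA (k + 1) L) ∧
      (1 ≤ k → ∃ M : Set (E → RS), ConfOpen E X M ∧ φ ∈ M ∧
        (∀ ψ ∈ M, range ψ ⊆ A) ∧ ∀ ψ ∈ M, KDiffAtA X f k ψ A hA)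

/-- `k` times differentiability at `Σ` (for every domain containing `γ(Σ)`). -/
def KTimesDiffAt (X : ExhChoice) (f : (E → RS) → ℂ) (k : ℕ) (φ : E → RS) : Prop :=
  ∀ (A : Set RS) (hA : IsDomain A), range φ ⊆ A → KDiffAtA E X f k φ A hA

/-- Differentiability at `Σ`. -/
def DiffAt (X : ExhChoice) (f : (E → RS) → ℂ) (φ : E → RS) : Prop :=
  KTimesDiffAt E X f 1 φ

/-- Smoothness on a set. -/
def SmoothOn (X : ExhChoice) (N : Set (E → RS)) (f : (E → RS) → ℂ) : Prop :=
  ∀ φ ∈ N, ∀ k : ℕ, KTimesDiffAt E X f k φ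

/-- Iterated application of a derivative operator `D` (slot `0` innermost). -/
def iterD (D : (ℂ → ℂ) → ((E → RS) → ℂ) → (E → RS) → ℂ) :
    ∀ k : ℕ, (Fin k → ℂ → ℂ) → ((E → RS) → ℂ) → (E → RS) → ℂ
  | 0, _, f => f
  | (k + 1), v, f => D (v (Fin.last k)) (fun ψ => iterD D k (fun i => v i.castSucc) f ψ)

/-- `D` is a conformal derivative operator: wherever a function has a `k`-th
differential, iterated applications of `D` compute it. -/
def IsNablaOp (X : ExhChoice) (D : (ℂ → ℂ) → ((E → RS) → ℂ) → (E → RS) → ℂ) : Prop :=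
  ∀ (f : (E → RS) → ℂ) (φ : E → RS) (A : Set RS) (hA : IsDomain A) (k : ℕ)
    (L : (Fin k → ℂ → ℂ) → ℂ) (v : Fin k → ℂ → ℂ),
    0 < k → (∀ i, v i ∈ HVFset A) → HasKDeriv E X f φ A hA k L →
    iterD E D k v f φ = L v

/-- The holomorphic derivative `Δ[h] = (∇_h - i ∇_{ih})/2`. -/
def Dh (D : (ℂ → ℂ) → ((E → RS) → ℂ) → (E → RS) → ℂ) (h : ℂ → ℂ) (f : (E → RS) → ℂ) :
    (E → RS) → ℂ :=
  fun φ => (1 / 2 : ℂ) * (D h f φ - Complex.I * D (fun z => Complex.I * h z) f φ)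

/-- The structure polynomials `k_ℓ(w)` of a conformal Gaussian. -/
def kpoly (d₁ d₂ d₃ : ℂ) (ℓ : ℤ) (w : ℂ) : ℂ :=
  if ℓ = -2 then d₁ * w ^ 2 + d₂ * w + d₃
  else if ℓ = -3 then -2 * d₁ * w - d₂
  else if ℓ = -4 then d₁ else 0

/-- The structure constants `(n-m) k_{n+m}(w) + (c/12)(n³-n) δ_{n+m,0}`. -/
def structConst (c d₁ d₂ d₃ : ℂ) (n m : ℤ) (w : ℂ) : ℂ :=
  ((n : ℂ) - (m : ℂ)) * kpoly d₁ d₂ d₃ (n + m) w +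
    (c / 12) * ((n : ℂ) ^ 3 - (n : ℂ)) * (if n + m = 0 then 1 else 0)

/-- The equation `Δ[h_{n;w}] Δ[h_{m;w}] log Z (Σ) = K` (order according to the sign of
`n+m`), interpreted at zeros of `Z` after multiplying through by `Z(Σ)²`. -/
def Gauss2Eq (D : (ℂ → ℂ) → ((E → RS) → ℂ) → (E → RS) → ℂ) (Z : (E → RS) → ℂ)
    (n m : ℤ) (w : ℂ) (φ : E → RS) (K : ℂ) : Prop :=
  if -1 ≤ n + m then
    Z φ * Dh E D (hvf n w) (Dh E D (hvf m w) Z) φ -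
      Dh E D (hvf n w) Z φ * Dh E D (hvf m w) Z φ = K * Z φ ^ 2
  else
    Z φ * Dh E D (hvf m w) (Dh E D (hvf n w) Z) φ -
      Dh E D (hvf m w) Z φ * Dh E D (hvf n w) Z φ = K * Z φ ^ 2

/-- A conformal Gaussian on an open set `N`: a smooth function whose ordered second
logarithmic derivatives at some base point `v` are independent of `Σ` on `N`. -/
def IsConfGaussian (X : ExhChoice) (D : (ℂ → ℂ) → ((E → RS) → ℂ) → (E → RS) → ℂ)
    (N : Set (E → RS)) (Z : (E → RS) → ℂ) : Prop :=
  SmoothOn E X N Z ∧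
  ∃ v : ℂ, (∀ φ ∈ N, ((v : ℂ) : RS) ∉ betaSetOf (range φ)) ∧
    ∀ n m : ℤ, -1 ≤ n → m ≤ -2 → ∃ K : ℂ, ∀ φ ∈ N, Gauss2Eq E D Z n m v φ K

/-- `Z` has the conformal-Gaussian structure with exponent `c` and anomaly `(d₁,d₂,d₃)`. -/
def HasGaussStructure (D : (ℂ → ℂ) → ((E → RS) → ℂ) → (E → RS) → ℂ)
    (N : Set (E → RS)) (Z : (E → RS) → ℂ) (c d₁ d₂ d₃ : ℂ) : Prop :=
  ∀ φ ∈ N, ∀ w : ℂ, ((w : ℂ) : RS) ∉ betaSetOf (range φ) →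
    ∀ n m : ℤ, -1 ≤ n → m ≤ -2 → Gauss2Eq E D Z n m w φ (structConst c d₁ d₂ d₃ n m w)

/-- α-holomorphicity of `f` at `Σ`: all antiholomorphic derivatives along vector fields
holomorphic on domains containing `α(Σ)` vanish. -/
def AlphaHolomorphicAt (D : (ℂ → ℂ) → ((E → RS) → ℂ) → (E → RS) → ℂ)
    (f : (E → RS) → ℂ) (φ : E → RS) : Prop :=
  ∀ A : Set RS, IsDomain A → alphaSetOf (range φ) ⊆ A →
    ∀ h ∈ HVFset A, D h f φ + Complex.I * D (fun z => Complex.I * h z) f φ = 0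

/-- Property H: `Δ[h_{-2;w}] log Z` is α-holomorphic at every `Σ ∈ N`, for every
`w ∈ ℂ∖β(Σ)`. -/
def PropertyH (D : (ℂ → ℂ) → ((E → RS) → ℂ) → (E → RS) → ℂ)
    (Z : (E → RS) → ℂ) (N : Set (E → RS)) : Prop :=
  ∀ φ ∈ N, ∀ w : ℂ, ((w : ℂ) : RS) ∉ betaSetOf (range φ) →
    AlphaHolomorphicAt E D (fun ψ => Dh E D (hvf (-2) w) Z ψ / Z ψ) φ

end OmegaSection

end CFT

namespace CFT

/-! ### Perturbations of the identity in the plane -/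

/-- A holomorphic vector field with uniform control of itself and of its derivative on `W`. -/
structure FieldBound (W : Set ℂ) (C : ℝ) (u : ℂ → ℂ) : Prop where
  diff : ∀ z ∈ W, DifferentiableAt ℂ u z
  bound : ∀ z ∈ W, ‖u z‖ ≤ C
  lip : ∀ z ∈ W, ∀ w ∈ W, ‖u z - u w‖ ≤ C * ‖z - w‖

lemma FieldBound.mono {W : Set ℂ} {C C' : ℝ} {u : ℂ → ℂ} (hu : FieldBound W C u) (hC : C ≤ C') :
    FieldBound W C' u where
  diff := hu.diff
  bound z hz := (hu.bound z hz).trans hC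
  lip z hz w hw := (hu.lip z hz w hw).trans (by gcongr)

lemma FieldBound.mono_set {W W' : Set ℂ} {C : ℝ} {u : ℂ → ℂ} (hu : FieldBound W C u)
    (hW : W' ⊆ W) : FieldBound W' C u where
  diff z hz := hu.diff z (hW hz)
  bound z hz := hu.bound z (hW hz)
  lip z hz w hw := hu.lip z (hW hz) w (hW hw)

lemma exists_fieldBound {V W : Set ℂ} {u : ℂ → ℂ} (hV : IsOpen V) (hW : IsCompact W)
    (hWV : W ⊆ V) (hu : DifferentiableOn ℂ u V) : ∃ C, FieldBound W C u := by
  obtain ⟨C₁, hC₁⟩ := hW.exists_bound_of_continuousOn (hu.continuousOn.mono hWV)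
  have hloc : LocallyLipschitzOn W u := by
    intro x hx
    have hd : ContDiffAt ℂ 1 u x := (hu.analyticAt (hV.mem_nhds (hWV hx))).contDiffAt
    obtain ⟨L, t, ht, hL⟩ := hd.exists_lipschitzOnWith
    exact ⟨L, t, mem_nhdsWithin_of_mem_nhds ht, hL⟩
  obtain ⟨L, hL⟩ := hloc.exists_lipschitzOnWith_of_compact hW
  refine ⟨max C₁ L, fun z hz => hu.differentiableAt (hV.mem_nhds (hWV hz)),
    fun z hz => (hC₁ z hz).trans (le_max_left _ _), fun z hz w hw => ?_⟩
  rw [← dist_eq_norm, ← dist_eq_norm]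
  exact (hL.dist_le_mul z hz w hw).trans (by gcongr; exact le_max_right _ _)

/-- The Euler step of the vector field `h` with step size `s`. -/
def eulerStep (h : ℂ → ℂ) (s : ℝ) (z : ℂ) : ℂ := z + s * h z

/-- An Euler step along `h'` followed by an Euler step along `h`. -/
def eulerTwo (h h' : ℂ → ℂ) (s : ℝ) (z : ℂ) : ℂ := eulerStep h s (eulerStep h' s z)

/-- The Lie bracket of vector fields. -/
def lieField (h h' : ℂ → ℂ) (z : ℂ) : ℂ := h z * deriv h' z - h' z * deriv h z

/-- A one-parameter family of maps equal to the identity plus `t * k` to first order,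
uniformly on `B`. -/
structure NearId (B : Set ℂ) (F : ℝ → ℂ → ℂ) (k : ℂ → ℂ) : Prop where
  bound : ∃ C, ∀ z ∈ B, ‖k z‖ ≤ C
  diff : ∀ᶠ t in 𝓝 (0 : ℝ), DifferentiableOn ℂ (F t) B
  inj : ∀ᶠ t in 𝓝 (0 : ℝ), InjOn (F t) B
  approx : ∀ η > 0, ∀ᶠ t in 𝓝 (0 : ℝ), ∀ z ∈ B, ‖F t z - z - t * k z‖ ≤ η * |t|

lemma norm_ofReal_mul_le {s a C : ℝ} {z : ℂ} (hz : ‖z‖ ≤ a) (h : |s| * a ≤ C) :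
    ‖(s : ℂ) * z‖ ≤ C := by
  rw [norm_mul, Complex.norm_real, Real.norm_eq_abs]
  exact (by gcongr : |s| * ‖z‖ ≤ |s| * a).trans h

lemma injOn_of_norm_sub_le {U : Set ℂ} {w : ℂ → ℂ}
    (hw : ∀ x ∈ U, ∀ y ∈ U, ‖(w x - x) - (w y - y)‖ ≤ 1 / 2 * ‖x - y‖) : InjOn w U := by
  intro x hx y hy hxy
  have h1 := hw x hx y hy
  rw [hxy, show w y - x - (w y - y) = -(x - y) by ring, norm_neg] at h1
  have h2 : ‖x - y‖ = 0 := by linarith [norm_nonneg (x - y)]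
  exact sub_eq_zero.mp (norm_eq_zero.mp h2)

lemma antilipschitz_of_norm_sub_le {U : Set ℂ} {w : ℂ → ℂ}
    (hw : ∀ x ∈ U, ∀ y ∈ U, ‖(w x - x) - (w y - y)‖ ≤ 1 / 2 * ‖x - y‖)
    {x y : ℂ} (hx : x ∈ U) (hy : y ∈ U) : 1 / 2 * ‖x - y‖ ≤ ‖w x - w y‖ := by
  have h1 := hw x hx y hy
  have h2 : ‖x - y‖ ≤ ‖w x - w y‖ + ‖(w x - x) - (w y - y)‖ := by
    rw [show x - y = (w x - w y) - ((w x - x) - (w y - y)) by ring]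
    exact norm_sub_le _ _
  linarith

/-- A small perturbation of the identity covers slightly smaller sets. -/
lemma exists_preimage_of_norm_sub_le {U : Set ℂ} {w : ℂ → ℂ} {δ : ℝ} (hδ : 0 < δ)
    (hw : ∀ x ∈ U, ∀ y ∈ U, ‖(w x - x) - (w y - y)‖ ≤ 1 / 2 * ‖x - y‖)
    (hd : DifferentiableOn ℂ w U) {y : ℂ} (hy : Metric.closedBall y δ ⊆ U)
    (hc : ‖w y - y‖ < δ / 4) : ∃ x ∈ U, w x = y := by
  have hyU : y ∈ U := hy (Metric.mem_closedBall_self hδ.le)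
  have hdc : DiffContOnCl ℂ w (Metric.ball y δ) := by
    apply DifferentiableOn.diffContOnCl
    exact hd.mono (Metric.closure_ball_subset_closedBall.trans hy)
  have hsub := hdc.ball_subset_image_closedBall (ε := δ / 2) hδ (fun z hz => by
    have hz' : ‖z - y‖ = δ := by simpa [dist_eq_norm] using hz
    have := antilipschitz_of_norm_sub_le hw (hy (Metric.sphere_subset_closedBall hz)) hyU
    linarith) (by
    apply Eventually.frequently (f := 𝓝[≠] y) _ |>.filter_mono nhdsWithin_le_nhds
    have hU : U ∈ 𝓝[≠] y := mem_nhdsWithin_of_mem_nhds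
      (mem_of_superset (Metric.closedBall_mem_nhds y hδ) hy)
    filter_upwards [hU, self_mem_nhdsWithin] with z hz hne h
    exact hne (injOn_of_norm_sub_le hw hz hyU h))
  obtain ⟨x, hx, hxy⟩ := hsub (show y ∈ Metric.ball (w y) (δ / 2 / 2) by
    rw [Metric.mem_ball, dist_comm, dist_eq_norm]; linarith)
  exact ⟨x, hy hx, hxy⟩

lemma differentiableAt_rightInverse {U B : Set ℂ} {w v : ℂ → ℂ} (hU : IsOpen U) (hB : IsOpen B)
    (hw : ∀ x ∈ U, ∀ y ∈ U, ‖(w x - x) - (w y - y)‖ ≤ 1 / 2 * ‖x - y‖)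
    (hd : DifferentiableOn ℂ w U) (hvU : ∀ y ∈ B, v y ∈ U) (hv : ∀ y ∈ B, w (v y) = y)
    {y : ℂ} (hy : y ∈ B) : DifferentiableAt ℂ v y := by
  have hcont : ContinuousAt v y := by
    have hlip : LipschitzOnWith 2 v B := by
      apply LipschitzOnWith.of_dist_le_mul
      intro a ha b hb
      have := antilipschitz_of_norm_sub_le hw (hvU a ha) (hvU b hb)
      rw [hv a ha, hv b hb] at this
      rw [dist_eq_norm, dist_eq_norm]
      push_cast
      linarith
    exact hlip.continuousOn.continuousAt (hB.mem_nhds hy)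
  have hdw : HasDerivAt w (deriv w (v y)) (v y) :=
    (hd.differentiableAt (hU.mem_nhds (hvU y hy))).hasDerivAt
  have hne : deriv w (v y) ≠ 0 := by
    intro h0
    rw [h0] at hdw
    have h1 : HasDerivAt (fun z => w z - z) (0 - 1) (v y) := hdw.sub (hasDerivAt_id _)
    have h2 : ‖(0 - 1 : ℂ)‖ ≤ 1 / 2 := by
      apply h1.le_of_lip' (by norm_num)
      filter_upwards [hU.mem_nhds (hvU y hy)] with x hx
      exact hw x hx _ (hvU y hy)
    norm_num at h2
  exact (HasDerivAt.of_local_left_inverse hcont hdw hne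
    (by filter_upwards [hB.mem_nhds hy] with z hz using hv z hz)).differentiableAt

section Step

variable {W U : Set ℂ} {C δ s : ℝ} {h h' : ℂ → ℂ}

lemma eulerStep_mem (hUW : ∀ z ∈ U, Metric.closedBall z δ ⊆ W) (hδ : 0 < δ)
    (hh : FieldBound W C h) (hs : |s| * C ≤ δ) {z : ℂ} (hz : z ∈ U) : eulerStep h s z ∈ W := by
  apply hUW z hz
  rw [Metric.mem_closedBall, dist_eq_norm, eulerStep, add_sub_cancel_left]
  exact norm_ofReal_mul_le (hh.bound z (hUW z hz (Metric.mem_closedBall_self hδ.le))) hs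

lemma eulerStep_diff (hh : FieldBound W C h) {z : ℂ} (hz : z ∈ W) :
    DifferentiableAt ℂ (eulerStep h s) z := by
  have := hh.diff z hz
  unfold eulerStep
  fun_prop

lemma eulerTwo_diff (hUW : ∀ z ∈ U, Metric.closedBall z δ ⊆ W) (hδ : 0 < δ)
    (hh : FieldBound W C h) (hh' : FieldBound W C h') (hs : |s| * C ≤ δ) {z : ℂ} (hz : z ∈ U) :
    DifferentiableAt ℂ (eulerTwo h h' s) z :=
  (eulerStep_diff hh (eulerStep_mem hUW hδ hh' hs hz)).comp z
    (eulerStep_diff hh' (hUW z hz (Metric.mem_closedBall_self hδ.le)))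

lemma eulerStep_norm_sub_le (hh : FieldBound W C h) {x y : ℂ} (hx : x ∈ W) (hy : y ∈ W) :
    ‖(eulerStep h s x - x) - (eulerStep h s y - y)‖ ≤ |s| * C * ‖x - y‖ := by
  rw [eulerStep, eulerStep, show x + s * h x - x - (y + s * h y - y) = s * (h x - h y) by ring]
  exact norm_ofReal_mul_le (hh.lip x hx y hy) (by rw [mul_assoc])

lemma eulerTwo_norm_sub_le (hUW : ∀ z ∈ U, Metric.closedBall z δ ⊆ W) (hδ : 0 < δ)
    (hh : FieldBound W C h) (hh' : FieldBound W C h') (hs : |s| * C ≤ δ)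
    (hs' : |s| * C ≤ 1 / 8) {x y : ℂ} (hx : x ∈ U) (hy : y ∈ U) :
    ‖(eulerTwo h h' s x - x) - (eulerTwo h h' s y - y)‖ ≤ 1 / 2 * ‖x - y‖ := by
  have hxW := hUW x hx (Metric.mem_closedBall_self hδ.le)
  have hyW := hUW y hy (Metric.mem_closedBall_self hδ.le)
  have e1 := eulerStep_norm_sub_le (s := s) hh' hxW hyW
  have e2 := eulerStep_norm_sub_le (s := s) hh (eulerStep_mem hUW hδ hh' hs hx)
    (eulerStep_mem hUW hδ hh' hs hy)
  set x' := eulerStep h' s x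
  set y' := eulerStep h' s y
  have e3 : ‖x' - y'‖ ≤ ‖x - y‖ + ‖(x' - x) - (y' - y)‖ := by
    rw [show x' - y' = (x - y) + ((x' - x) - (y' - y)) by ring]
    exact norm_add_le _ _
  have e4 : ‖(eulerTwo h h' s x - x) - (eulerTwo h h' s y - y)‖ ≤
      ‖(eulerStep h s x' - x') - (eulerStep h s y' - y')‖ + ‖(x' - x) - (y' - y)‖ := by
    rw [eulerTwo, eulerTwo, show eulerStep h s x' - x - (eulerStep h s y' - y) =
      ((eulerStep h s x' - x') - (eulerStep h s y' - y')) + ((x' - x) - (y' - y)) by ring]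
    exact norm_add_le _ _
  have h0 := norm_nonneg (x - y)
  have e5 : |s| * C * ‖x - y‖ ≤ 1 / 8 * ‖x - y‖ := by gcongr
  have e6 : |s| * C * ‖x' - y'‖ ≤ 1 / 8 * ‖x' - y'‖ := by gcongr
  linarith

lemma eulerTwo_sub_le (hUW : ∀ z ∈ U, Metric.closedBall z δ ⊆ W) (hδ : 0 < δ)
    (hh : FieldBound W C h) (hh' : FieldBound W C h') (hs : |s| * C ≤ δ) {x : ℂ} (hx : x ∈ U) :
    ‖eulerTwo h h' s x - x‖ ≤ 2 * (|s| * C) := by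
  have h1 := norm_ofReal_mul_le (hh'.bound x (hUW x hx (Metric.mem_closedBall_self hδ.le)))
    (le_refl (|s| * C))
  have h2 := norm_ofReal_mul_le (hh.bound _ (eulerStep_mem hUW hδ hh' hs hx))
    (le_refl (|s| * C))
  rw [eulerTwo, eulerStep]
  nth_rewrite 1 [eulerStep]
  rw [show x + s * h' x + s * h (eulerStep h' s x) - x =
    s * h' x + s * h (eulerStep h' s x) by ring]
  exact (norm_add_le _ _).trans (by linarith)

lemma taylor_le (hUW : ∀ z ∈ U, Metric.closedBall z δ ⊆ W)
    (hh : FieldBound W C h) (hdh : FieldBound W C (deriv h)) {x v : ℂ} (hC : 0 ≤ C) (hx : x ∈ U)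
    (hv : ‖v‖ ≤ δ) : ‖h (x + v) - h x - v * deriv h x‖ ≤ C * ‖v‖ ^ 2 := by
  have hsub : Metric.closedBall x ‖v‖ ⊆ W := (Metric.closedBall_subset_closedBall hv).trans
    (hUW x hx)
  have hmem : x ∈ Metric.closedBall x ‖v‖ := Metric.mem_closedBall_self (norm_nonneg v)
  have key := (convex_closedBall x ‖v‖).norm_image_sub_le_of_norm_hasDerivWithin_le
    (f := fun z => h z - z * deriv h x) (f' := fun z => deriv h z - 1 * deriv h x)
    (C := C * ‖v‖) (x := x) (y := x + v)
    (fun z hz => (((hh.diff z (hsub hz)).hasDerivAt).sub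
      ((hasDerivAt_id z).mul_const (deriv h x))).hasDerivWithinAt)
    (fun z hz => by
      rw [one_mul]
      refine (hdh.lip z (hsub hz) x (hsub hmem)).trans ?_
      gcongr
      simpa [dist_eq_norm] using hz)
    hmem (by simp)
  rw [show h (x + v) - h x - v * deriv h x =
    h (x + v) - (x + v) * deriv h x - (h x - x * deriv h x) by ring]
  refine key.trans (le_of_eq ?_)
  rw [add_sub_cancel_left]
  ring

lemma lieField_fieldBound (hC : 0 ≤ C) (hh : FieldBound W C h) (hh' : FieldBound W C h')
    (hdh : FieldBound W C (deriv h)) (hdh' : FieldBound W C (deriv h')) :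
    FieldBound W (4 * C ^ 2) (lieField h h') := by
  have hmul : ∀ {a b : ℂ → ℂ}, FieldBound W C a → FieldBound W C b → ∀ z ∈ W, ∀ w ∈ W,
      ‖a z * b z - a w * b w‖ ≤ 2 * C ^ 2 * ‖z - w‖ := by
    intro a b ha hb z hz w hw
    have h1 : ‖a z * (b z - b w)‖ ≤ C * (C * ‖z - w‖) := by
      rw [norm_mul]
      exact mul_le_mul (ha.bound z hz) (hb.lip z hz w hw) (norm_nonneg _) hC
    have h2 : ‖(a z - a w) * b w‖ ≤ (C * ‖z - w‖) * C := by
      rw [norm_mul]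
      exact mul_le_mul (ha.lip z hz w hw) (hb.bound w hw) (norm_nonneg _) (by positivity)
    rw [show a z * b z - a w * b w = a z * (b z - b w) + (a z - a w) * b w by ring]
    exact (norm_add_le _ _).trans (by linarith)
  have hbd : ∀ {a b : ℂ → ℂ}, FieldBound W C a → FieldBound W C b → ∀ z ∈ W,
      ‖a z * b z‖ ≤ C ^ 2 := by
    intro a b ha hb z hz
    rw [norm_mul, sq]
    exact mul_le_mul (ha.bound z hz) (hb.bound z hz) (norm_nonneg _) hC
  refine ⟨fun z hz => ?_, fun z hz => ?_, fun z hz w hw => ?_⟩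
  · exact ((hh.diff z hz).mul (hdh'.diff z hz)).sub ((hh'.diff z hz).mul (hdh.diff z hz))
  · have h1 := hbd hh hdh' z hz
    have h2 := hbd hh' hdh z hz
    exact (norm_sub_le _ _).trans (by nlinarith)
  · have h1 := hmul hh hdh' z hz w hw
    have h2 := hmul hh' hdh z hz w hw
    rw [lieField, lieField, show h z * deriv h' z - h' z * deriv h z -
      (h w * deriv h' w - h' w * deriv h w) = (h z * deriv h' z - h w * deriv h' w) -
      (h' z * deriv h z - h' w * deriv h w) by ring]
    exact (norm_sub_le _ _).trans (by linarith)

/-- The commutator of two Euler steps is a step of size `s ^ 2` along the Lie bracket. -/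
lemma eulerTwo_comm_le (hUW : ∀ z ∈ U, Metric.closedBall z δ ⊆ W) (hδ : 0 < δ) (hC : 0 ≤ C)
    (hh : FieldBound W C h) (hh' : FieldBound W C h')
    (hdh : FieldBound W C (deriv h)) (hdh' : FieldBound W C (deriv h'))
    (hs : |s| * C ≤ δ) {x : ℂ} (hx : x ∈ U) :
    ‖eulerTwo h' h s x - eulerTwo h h' s x - (s : ℂ) ^ 2 * lieField h h' x‖ ≤
      2 * C ^ 3 * |s| ^ 3 := by
  have hxW := hUW x hx (Metric.mem_closedBall_self hδ.le)
  have main : ∀ {a b : ℂ → ℂ}, FieldBound W C a → FieldBound W C b → FieldBound W C (deriv a) →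
      ‖(s : ℂ) * (a (x + s * b x) - a x - s * b x * deriv a x)‖ ≤ C ^ 3 * |s| ^ 3 := by
    intro a b ha hb hda
    have hv : ‖(s : ℂ) * b x‖ ≤ |s| * C := norm_ofReal_mul_le (hb.bound x hxW) le_rfl
    refine norm_ofReal_mul_le (taylor_le hUW ha hda hC hx (hv.trans hs)) ?_
    calc |s| * (C * ‖(s : ℂ) * b x‖ ^ 2) ≤ |s| * (C * (|s| * C) ^ 2) := by gcongr
      _ = C ^ 3 * |s| ^ 3 := by ring
  have m1 := main hh' hh hdh'
  have m2 := main hh hh' hdh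
  rw [show eulerTwo h' h s x - eulerTwo h h' s x - (s : ℂ) ^ 2 * lieField h h' x =
    (s : ℂ) * (h' (x + s * h x) - h' x - s * h x * deriv h' x) -
    (s : ℂ) * (h (x + s * h' x) - h x - s * h' x * deriv h x) by
      simp only [eulerTwo, eulerStep, lieField]; ring]
  exact (norm_sub_le _ _).trans (by linarith)

end Step

lemma eventually_abs_mul_le (a : ℝ) {ε : ℝ} (hε : 0 < ε) : ∀ᶠ t in 𝓝 (0 : ℝ), |t| * a ≤ ε := by
  have : Tendsto (fun t : ℝ => |t| * a) (𝓝 0) (𝓝 0) := by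
    have h : Continuous fun t : ℝ => |t| * a := by fun_prop
    simpa using h.tendsto 0
  exact this.eventually (eventually_le_nhds hε)

section Families

variable {B U W : Set ℂ} {C δ : ℝ} {h h' : ℂ → ℂ}

lemma nearId_eulerStep (hh : FieldBound B C h) : NearId B (eulerStep h) h where
  bound := ⟨C, hh.bound⟩
  diff := Eventually.of_forall fun t z hz => (eulerStep_diff hh hz).differentiableWithinAt
  inj := by
    filter_upwards [eventually_abs_mul_le C (half_pos one_pos)] with t ht
    refine injOn_of_norm_sub_le fun x hx y hy => (eulerStep_norm_sub_le hh hx hy).trans ?_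
    gcongr
  approx η hη := Eventually.of_forall fun t z _ => by
    rw [eulerStep, show z + t * h z - z - t * h z = 0 by ring, norm_zero]
    positivity

lemma nearId_eulerTwo (hUW : ∀ z ∈ U, Metric.closedBall z δ ⊆ W) (hδ : 0 < δ) (hC : 0 ≤ C)
    (hh : FieldBound W C h) (hh' : FieldBound W C h') :
    NearId U (eulerTwo h h') (fun z => h z + h' z) where
  bound := ⟨C + C, fun z hz => (norm_add_le _ _).trans (add_le_add
    (hh.bound z (hUW z hz (Metric.mem_closedBall_self hδ.le)))
    (hh'.bound z (hUW z hz (Metric.mem_closedBall_self hδ.le))))⟩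
  diff := by
    filter_upwards [eventually_abs_mul_le C hδ] with t ht z hz
    exact (eulerTwo_diff hUW hδ hh hh' ht hz).differentiableWithinAt
  inj := by
    filter_upwards [eventually_abs_mul_le C hδ, eventually_abs_mul_le C (ε := 1 / 8) (by norm_num)]
      with t ht ht'
    exact injOn_of_norm_sub_le fun x hx y hy => eulerTwo_norm_sub_le hUW hδ hh hh' ht ht' hx hy
  approx η hη := by
    filter_upwards [eventually_abs_mul_le C hδ, eventually_abs_mul_le (C * C) hη] with t ht ht' z hz
    have hzW := hUW z hz (Metric.mem_closedBall_self hδ.le)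
    have hv : ‖(t : ℂ) * h' z‖ ≤ |t| * C := norm_ofReal_mul_le (hh'.bound z hzW) le_rfl
    have h1 := hh.lip _ (eulerStep_mem hUW hδ hh' ht hz) z hzW
    rw [show eulerTwo h h' t z - z - t * (h z + h' z) = t * (h (eulerStep h' t z) - h z) by
      simp only [eulerTwo, eulerStep]; ring]
    refine norm_ofReal_mul_le h1 ?_
    rw [eulerStep, add_sub_cancel_left]
    calc |t| * (C * ‖(t : ℂ) * h' z‖) ≤ |t| * (C * (|t| * C)) := by gcongr
      _ = (|t| * (C * C)) * |t| := by ring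
      _ ≤ η * |t| := by gcongr

/-- The map carrying one ordering of two Euler steps to the other. -/
def commMap (U : Set ℂ) (h h' : ℂ → ℂ) (s : ℝ) (y : ℂ) : ℂ :=
  eulerTwo h' h s (Function.invFunOn (eulerTwo h h' s) U y)

/-- `commMap` reparametrized by the square of the step, extended to nonpositive parameters by
Euler steps of the Lie bracket. -/
def commFamily (U : Set ℂ) (h h' : ℂ → ℂ) (t : ℝ) : ℂ → ℂ :=
  if 0 < t then commMap U h h' (Real.sqrt t) else eulerStep (lieField h h') t

lemma commMap_apply {s : ℝ} (hinj : InjOn (eulerTwo h h' s) U) {x : ℂ} (hx : x ∈ U) :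
    commMap U h h' s (eulerTwo h h' s x) = eulerTwo h' h s x := by
  rw [commMap, hinj.leftInvOn_invFunOn hx]

lemma commMap_props (hU : IsOpen U) (hB : IsOpen B)
    (hBU : ∀ z ∈ B, Metric.closedBall z δ ⊆ U)
    (hUW : ∀ z ∈ U, Metric.closedBall z δ ⊆ W) (hδ : 0 < δ) (hC : 0 ≤ C)
    (hh : FieldBound W C h) (hh' : FieldBound W C h')
    (hdh : FieldBound W C (deriv h)) (hdh' : FieldBound W C (deriv h'))
    {s : ℝ} (hs : |s| * C ≤ δ / 16) (hs' : |s| * C ≤ 1 / 8) :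
    DifferentiableOn ℂ (commMap U h h' s) B ∧ InjOn (commMap U h h' s) B ∧
      ∀ y ∈ B, ‖commMap U h h' s y - y - (s : ℂ) ^ 2 * lieField h h' y‖ ≤
        10 * C ^ 3 * |s| ^ 3 := by
  have hsδ : |s| * C ≤ δ := by linarith
  have hw : ∀ x ∈ U, ∀ y ∈ U,
      ‖(eulerTwo h h' s x - x) - (eulerTwo h h' s y - y)‖ ≤ 1 / 2 * ‖x - y‖ :=
    fun x hx y hy => eulerTwo_norm_sub_le hUW hδ hh hh' hsδ hs' hx hy
  have hd : DifferentiableOn ℂ (eulerTwo h h' s) U :=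
    fun z hz => (eulerTwo_diff hUW hδ hh hh' hsδ hz).differentiableWithinAt
  have hex : ∀ y ∈ B, ∃ x ∈ U, eulerTwo h h' s x = y := by
    intro y hy
    have hyU : y ∈ U := hBU y hy (Metric.mem_closedBall_self hδ.le)
    refine exists_preimage_of_norm_sub_le hδ hw hd (hBU y hy) ?_
    have := eulerTwo_sub_le hUW hδ hh hh' hsδ hyU
    linarith
  set v := Function.invFunOn (eulerTwo h h' s) U with hv_def
  have hvU : ∀ y ∈ B, v y ∈ U := fun y hy => Function.invFunOn_mem (hex y hy)
  have hv : ∀ y ∈ B, eulerTwo h h' s (v y) = y := fun y hy => Function.invFunOn_eq (hex y hy)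
  refine ⟨fun y hy => ?_, fun y hy z hz hyz => ?_, fun y hy => ?_⟩
  · exact ((eulerTwo_diff hUW hδ hh' hh hsδ (hvU y hy)).comp y
      (differentiableAt_rightInverse hU hB hw hd hvU hv hy)).differentiableWithinAt
  · have hinj : InjOn (eulerTwo h' h s) U := injOn_of_norm_sub_le fun x hx y hy =>
      eulerTwo_norm_sub_le hUW hδ hh' hh hsδ hs' hx hy
    have := hinj (hvU y hy) (hvU z hz) hyz
    rw [← hv y hy, ← hv z hz, this]
  · have hyU : y ∈ U := hBU y hy (Metric.mem_closedBall_self hδ.le)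
    have hself : ∀ z ∈ U, z ∈ W := fun z hz => hUW z hz (Metric.mem_closedBall_self hδ.le)
    have e1 := eulerTwo_comm_le hUW hδ hC hh hh' hdh hdh' hsδ (hvU y hy)
    have e2 := eulerTwo_sub_le hUW hδ hh hh' hsδ (hvU y hy)
    have e3 := (lieField_fieldBound hC hh hh' hdh hdh').lip _ (hself _ (hvU y hy)) _ (hself _ hyU)
    rw [hv y hy] at e1 e2
    have e4 : ‖(s : ℂ) ^ 2 * (lieField h h' (v y) - lieField h h' y)‖ ≤ 8 * C ^ 3 * |s| ^ 3 := by
      rw [norm_mul, norm_pow, Complex.norm_real, Real.norm_eq_abs]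
      rw [norm_sub_rev] at e2
      calc |s| ^ 2 * ‖lieField h h' (v y) - lieField h h' y‖
          ≤ |s| ^ 2 * (4 * C ^ 2 * (2 * (|s| * C))) := by
            gcongr
            exact e3.trans (by gcongr)
        _ = 8 * C ^ 3 * |s| ^ 3 := by ring
    rw [commMap, ← hv_def, show eulerTwo h' h s (v y) - y - (s : ℂ) ^ 2 * lieField h h' y =
      (eulerTwo h' h s (v y) - y - (s : ℂ) ^ 2 * lieField h h' (v y)) +
      (s : ℂ) ^ 2 * (lieField h h' (v y) - lieField h h' y) by ring]
    exact (norm_add_le _ _).trans (by linarith)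

lemma nearId_commFamily (hU : IsOpen U) (hB : IsOpen B)
    (hBU : ∀ z ∈ B, Metric.closedBall z δ ⊆ U)
    (hUW : ∀ z ∈ U, Metric.closedBall z δ ⊆ W) (hδ : 0 < δ) (hC : 0 ≤ C)
    (hh : FieldBound W C h) (hh' : FieldBound W C h')
    (hdh : FieldBound W C (deriv h)) (hdh' : FieldBound W C (deriv h')) :
    NearId B (commFamily U h h') (lieField h h') := by
  have hBW : B ⊆ W := fun z hz => hUW z (hBU z hz (Metric.mem_closedBall_self hδ.le))
    (Metric.mem_closedBall_self hδ.le)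
  have hstep := nearId_eulerStep
    ((lieField_fieldBound hC hh hh' hdh hdh').mono_set hBW)
  have hsqrt : Tendsto Real.sqrt (𝓝 0) (𝓝 0) := by
    simpa using Real.continuous_sqrt.tendsto 0
  have hprops := (hsqrt.eventually ((eventually_abs_mul_le C (ε := δ / 16) (by positivity)).and
    (eventually_abs_mul_le C (ε := 1 / 8) (by norm_num)))).mono fun t ht =>
      commMap_props hU hB hBU hUW hδ hC hh hh' hdh hdh' ht.1 ht.2
  refine ⟨hstep.bound, ?_, ?_, fun η hη => ?_⟩
  · filter_upwards [hprops, hstep.diff] with t h1 h2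
    unfold commFamily
    split_ifs
    exacts [h1.1, h2]
  · filter_upwards [hprops, hstep.inj] with t h1 h2
    unfold commFamily
    split_ifs
    exacts [h1.2.1, h2]
  · filter_upwards [hprops, hstep.approx η hη,
      hsqrt.eventually (eventually_abs_mul_le (10 * C ^ 3) hη)] with t h1 h2 h3 z hz
    unfold commFamily
    split_ifs with ht
    · have e := h1.2.2 z hz
      rw [← Complex.ofReal_pow, Real.sq_sqrt ht.le] at e
      refine e.trans ?_
      calc 10 * C ^ 3 * |√t| ^ 3 = (|√t| * (10 * C ^ 3)) * |√t| ^ 2 := by ring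
        _ ≤ η * |√t| ^ 2 := by gcongr
        _ = η * |t| := by rw [sq_abs, Real.sq_sqrt ht.le, abs_of_pos ht]
    · exact h2 z hz

end Families

/-! ### Conformal maps of the sphere from maps of the plane -/

@[simp] lemma toC_coe (z : ℂ) : toC (z : RS) = z := rfl

lemma sphHolAt_map {F : ℂ → ℂ} {z : ℂ} (hF : AnalyticAt ℂ F z) :
    SphHolAt (OnePoint.map F) (z : RS) := by
  refine ⟨?_, ?_⟩
  · rw [OnePoint.continuousAt_coe]
    exact (OnePoint.continuous_coe.continuousAt).comp hF.continuousAt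
  · simpa using hF

lemma finitePart_image (B : Set ℂ) : finitePart ((↑) '' B : Set RS) = B := by
  ext z
  simp [finitePart]

lemma infty_notMem_image (B : Set ℂ) : OnePoint.infty ∉ ((↑) '' B : Set RS) := by
  simp

/-- The conformal map with domain `B` induced by an injective holomorphic function on `B`
(by the identity, if `F` is not such a function). -/
def planarMap (B : Set ℂ) (hB : IsOpen B) (hne : B.Nonempty) (F : ℂ → ℂ) : ConfMap where
  dom := (↑) '' B
  toFun := if DifferentiableOn ℂ F B ∧ InjOn F B then OnePoint.map F else OnePoint.map id
  isOpen_dom := OnePoint.isOpen_image_coe.2 hB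
  nonempty_dom := hne.image _
  dom_ne_univ h := infty_notMem_image B (h ▸ mem_univ _)
  holo := by
    rintro _ ⟨z, hz, rfl⟩
    split_ifs with hF
    · exact sphHolAt_map (hF.1.analyticAt (hB.mem_nhds hz))
    · exact sphHolAt_map analyticAt_id
  injOn := by
    split_ifs with hF
    · rintro _ ⟨z, hz, rfl⟩ _ ⟨w, hw, rfl⟩ h
      simp only [OnePoint.map_some, OnePoint.coe_eq_coe] at h
      rw [hF.2 hz hw h]
    · simp [injOn_id]

lemma planarMap_toFun {B : Set ℂ} (hB : IsOpen B) (hne : B.Nonempty) {F : ℂ → ℂ}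
    (hd : DifferentiableOn ℂ F B) (hi : InjOn F B) :
    (planarMap B hB hne F).toFun = OnePoint.map F := if_pos ⟨hd, hi⟩

lemma chord_coe_le (z w : ℂ) : chord (z : RS) (w : RS) ≤ ‖z - w‖ := by
  change ‖z - w‖ / (Real.sqrt (1 + ‖z‖ ^ 2) * Real.sqrt (1 + ‖w‖ ^ 2)) ≤ ‖z - w‖
  apply div_le_self (norm_nonneg _)
  have h1 : 1 ≤ Real.sqrt (1 + ‖z‖ ^ 2) := Real.one_le_sqrt.2 (by nlinarith [sq_nonneg ‖z‖])
  have h2 : 1 ≤ Real.sqrt (1 + ‖w‖ ^ 2) := Real.one_le_sqrt.2 (by nlinarith [sq_nonneg ‖w‖])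
  nlinarith

lemma chord_coe_nonneg (z w : ℂ) : 0 ≤ chord (z : RS) (w : RS) := by
  change 0 ≤ ‖z - w‖ / (Real.sqrt (1 + ‖z‖ ^ 2) * Real.sqrt (1 + ‖w‖ ^ 2))
  positivity

lemma deltaA_mem_Icc {B : Set ℂ} (e : Exhaustion ((↑) '' B : Set RS)) {g : ConfMap}
    {F : ℂ → ℂ} (hdom : g.dom = (↑) '' B) (hg : g.toFun = OnePoint.map F) {c : ℝ} (hc : 0 ≤ c)
    (hF : ∀ z ∈ B, ‖F z - z‖ ≤ c) : deltaA e g ∈ Icc 0 c := by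
  have hD : ∀ n, e.D n ⊆ (↑) '' B := fun n => by
    conv_rhs => rw [← e.iUnion_eq]
    exact subset_iUnion e.D n
  have hterm : ∀ n, (if e.D n ⊆ g.dom then sSup ((fun z => chord (g.toFun z) z) '' e.D n) else 1)
      ∈ Icc 0 c := by
    intro n
    rw [if_pos ((hD n).trans hdom.ge), hg]
    constructor
    · apply Real.sSup_nonneg
      rintro _ ⟨p, hp, rfl⟩
      obtain ⟨z, -, rfl⟩ := hD n hp
      exact chord_coe_nonneg _ _
    · apply Real.sSup_le _ hc
      rintro _ ⟨p, hp, rfl⟩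
      obtain ⟨z, hz, rfl⟩ := hD n hp
      exact (chord_coe_le _ _).trans (hF z hz)
  have hsum : HasSum (fun n : ℕ => (2 : ℝ)⁻¹ ^ (n + 1) * c) c := by
    have h1 := ((hasSum_geometric_of_lt_one (r := (2 : ℝ)⁻¹) (by norm_num)
      (by norm_num)).mul_left (2 : ℝ)⁻¹).mul_right c
    simp only [← pow_succ'] at h1
    rwa [show (2 : ℝ)⁻¹ * (1 - 2⁻¹)⁻¹ * c = c by norm_num] at h1
  refine ⟨tsum_nonneg fun n => mul_nonneg (by positivity) (hterm n).1, ?_⟩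
  rw [← hsum.tsum_eq]
  have hle : ∀ n : ℕ, (2 : ℝ)⁻¹ ^ (n + 1) *
      (if e.D n ⊆ g.dom then sSup ((fun z => chord (g.toFun z) z) '' e.D n) else 1) ≤
      (2 : ℝ)⁻¹ ^ (n + 1) * c := fun n => by
    gcongr
    exact (hterm n).2
  exact Summable.tsum_le_tsum hle (Summable.of_nonneg_of_le
    (fun n => mul_nonneg (by positivity) (hterm n).1) hle hsum.summable) hsum.summable

section NearIdentity

variable {B : Set ℂ} {F : ℝ → ℂ → ℂ} {k : ℂ → ℂ}

lemma NearId.eventually_toFun (hF : NearId B F k) (hB : IsOpen B) (hne : B.Nonempty) :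
    ∀ᶠ t in 𝓝 (0 : ℝ), (planarMap B hB hne (F t)).toFun = OnePoint.map (F t) := by
  filter_upwards [hF.diff, hF.inj] with t h1 h2 using planarMap_toFun hB hne h1 h2

lemma NearId.tendsto_deltaA (hF : NearId B F k) (hB : IsOpen B) (hne : B.Nonempty)
    (e : Exhaustion ((↑) '' B : Set RS)) :
    Tendsto (fun t => deltaA e (planarMap B hB hne (F t))) (𝓝 0) (𝓝 0) := by
  obtain ⟨C, hC⟩ := hF.bound
  have hC0 : 0 ≤ C := (norm_nonneg _).trans (hC _ hne.some_mem)
  have hev : ∀ᶠ t in 𝓝 (0 : ℝ), deltaA e (planarMap B hB hne (F t)) ∈ Icc 0 (|t| * (C + 1)) := by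
    filter_upwards [hF.eventually_toFun hB hne, hF.approx 1 one_pos] with t h1 h2
    refine deltaA_mem_Icc e rfl h1 (by positivity) fun z hz => ?_
    have h3 := h2 z hz
    have h4 : ‖(t : ℂ) * k z‖ ≤ |t| * C := norm_ofReal_mul_le (hC z hz) le_rfl
    rw [show F t z - z = (F t z - z - t * k z) + t * k z by ring]
    exact (norm_add_le _ _).trans (by linarith)
  have hlim : Tendsto (fun t : ℝ => |t| * (C + 1)) (𝓝 0) (𝓝 0) := by
    have h : Continuous fun t : ℝ => |t| * (C + 1) := by fun_prop
    simpa using h.tendsto 0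
  exact tendsto_of_tendsto_of_tendsto_of_le_of_le' tendsto_const_nhds hlim
    (hev.mono fun _ h => h.1) (hev.mono fun _ h => h.2)

lemma NearId.tendstoUniformlyOn (hF : NearId B F k) (hB : IsOpen B) (hne : B.Nonempty) :
    TendstoUniformlyOn
      (fun (t : ℝ) (z : ℂ) => t⁻¹ • (toC ((planarMap B hB hne (F t)).toFun (z : RS)) - z)) k
      (𝓝[≠] 0) B := by
  rw [Metric.tendstoUniformlyOn_iff]
  intro ε hε
  filter_upwards [(hF.eventually_toFun hB hne).filter_mono nhdsWithin_le_nhds,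
    (hF.approx (ε / 2) (half_pos hε)).filter_mono nhdsWithin_le_nhds,
    self_mem_nhdsWithin] with t h1 h2 ht z hz
  have ht0 : (t : ℂ) ≠ 0 := by exact_mod_cast ht
  have htpos : 0 < |t| := abs_pos.2 ht
  rw [h1, OnePoint.map_some, toC_coe, dist_comm, dist_eq_norm, Complex.real_smul,
    Complex.ofReal_inv, show (t : ℂ)⁻¹ * (F t z - z) - k z = (t : ℂ)⁻¹ * (F t z - z - t * k z) by
      field_simp, norm_mul, norm_inv, Complex.norm_real, Real.norm_eq_abs]
  calc |t|⁻¹ * ‖F t z - z - t * k z‖ ≤ |t|⁻¹ * (ε / 2 * |t|) := by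
        gcongr
        exact h2 z hz
    _ = ε / 2 := by field_simp
    _ < ε := half_lt_self hε

lemma isDomain_image (hB : IsOpen B) (hne : B.Nonempty) : IsDomain ((↑) '' B : Set RS) :=
  ⟨OnePoint.isOpen_image_coe.2 hB, hne.image _, fun h => infty_notMem_image B (h ▸ mem_univ _)⟩

lemma familyOK_planarMap (X : ExhChoice) (hB : IsOpen B) (hne : B.Nonempty) {m : ℕ}
    {F : Fin m → ℝ → ℂ → ℂ} {k : Fin m → ℂ → ℂ} (hF : ∀ j, NearId B (F j) (k j)) :
    FamilyOK X (isDomain_image hB hne)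
      (fun (t : Fin m → ℝ) j => planarMap B hB hne (F j (t j))) k := by
  have ht : ∀ j, Tendsto (fun t : Fin m → ℝ => t j) (𝓝 0) (𝓝 0) := fun j =>
    (continuous_apply j).tendsto (0 : Fin m → ℝ)
  refine ⟨fun j => ((hF j).tendsto_deltaA hB hne _).comp (ht j), fun j => ?_⟩
  rw [finitePart_image]
  refine TendstoUniformlyOn.tendstoLocallyUniformlyOn ?_
  have hj : Tendsto (fun t : Fin m → ℝ => t j) (𝓝[{t | t j ≠ 0}] 0) (𝓝[≠] 0) :=
    (ht j).inf (tendsto_principal_principal.2 fun t h => h)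
  exact fun u hu => hj.eventually ((hF j).tendstoUniformlyOn hB hne u hu)

lemma mem_HVFset_image {h : ℂ → ℂ} (hh : DifferentiableOn ℂ h B) :
    h ∈ HVFset ((↑) '' B : Set RS) := by
  refine ⟨by rwa [finitePart_image], fun h => absurd h (infty_notMem_image B)⟩

end NearIdentity

/-! ### Multi-differences along planar families -/

section Differences

variable {E : Set RS}

/-- Evaluation of `f` at the image of `φ` under a map of the plane. -/
def pullEval (f : (E → RS) → ℂ) (φ : E → RS) (F : ℂ → ℂ) : ℂ :=
  f fun x => OnePoint.map F (φ x)

lemma pullEval_congr (f : (E → RS) → ℂ) {φ : E → RS} {K : Set ℂ}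
    (hφ : ∀ x, φ x ∈ ((↑) '' K : Set RS)) {F G : ℂ → ℂ} (h : EqOn F G K) : pullEval f φ F = pullEval f φ G := by
  unfold pullEval
  congr 1
  ext1 x
  obtain ⟨z, hz, hx⟩ := hφ x
  rw [← hx, OnePoint.map_some, OnePoint.map_some, h hz]

lemma sum_finset_fin_one (q : Finset (Fin 1) → ℂ) : ∑ S, q S = q ∅ + q {0} := by
  have h : (Finset.univ : Finset (Fin 1)) = insert 0 ∅ := by
    ext i; fin_cases i; simp
  rw [← Finset.powerset_univ, h, Finset.sum_powerset_insert (by simp)]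
  simp

lemma sum_finset_fin_two (q : Finset (Fin 2) → ℂ) :
    ∑ S, q S = q ∅ + q {1} + (q {0} + q {0, 1}) := by
  have h : (Finset.univ : Finset (Fin 2)) = insert 0 (insert 1 ∅) := by
    ext i; fin_cases i <;> simp
  rw [← Finset.powerset_univ, h, Finset.sum_powerset_insert (by simp),
    Finset.sum_powerset_insert (by simp), Finset.sum_powerset_insert (by simp)]
  simp

lemma sort_fin_two : ({0, 1} : Finset (Fin 2)).sort (· ≤ ·) = [0, 1] := by
  have h := Finset.sort_insert (r := (· ≤ ·)) (s := ({1} : Finset (Fin 2))) (a := 0)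
    (fun b _ => Fin.zero_le b) (by simp)
  rw [Finset.sort_singleton] at h
  convert h

section ApplyFam

variable {m : ℕ} (g : (Fin m → ℝ) → Fin m → ConfMap) (t : Fin m → ℝ) (φ : E → RS)

lemma applyFam_empty : applyFam E g t ∅ φ = φ := by
  ext1 x
  simp [applyFam]

lemma applyFam_singleton (j : Fin m) :
    applyFam E g t {j} φ = fun x => (g t j).toFun (φ x) := by
  ext1 x
  simp [applyFam]

lemma applyFam_pair (g : (Fin 2 → ℝ) → Fin 2 → ConfMap) (t : Fin 2 → ℝ) :
    applyFam E g t {0, 1} φ = fun x => (g t 0).toFun ((g t 1).toFun (φ x)) := by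
  ext1 x
  rw [applyFam, sort_fin_two]
  rfl

end ApplyFam

variable {B : Set ℂ} {f : (E → RS) → ℂ} {φ : E → RS} {X : ExhChoice}

lemma HasKDeriv.tendsto_one (hB : IsOpen B) (hne : B.Nonempty) {L : (Fin 1 → ℂ → ℂ) → ℂ}
    (hL : HasKDeriv E X f φ ((↑) '' B) (isDomain_image hB hne) 1 L)
    {F : ℝ → ℂ → ℂ} {k : ℂ → ℂ} (hF : NearId B F k) (hk : DifferentiableOn ℂ k B) :
    Tendsto (fun t : ℝ => (t : ℂ)⁻¹ * (pullEval f φ (F t) - f φ)) (𝓝[≠] 0) (𝓝 (L ![k])) := by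
  have h := hL.2 _ ![k] (fun j => by fin_cases j; exact mem_HVFset_image hk)
    (familyOK_planarMap X hB hne (F := ![F]) (k := ![k]) (fun j => by fin_cases j; exact hF))
  have ht : Tendsto (fun t : ℝ => (![t] : Fin 1 → ℝ)) (𝓝[≠] 0)
      (𝓝[{t : Fin 1 → ℝ | ∀ j, t j ≠ 0}] 0) := by
    refine tendsto_nhdsWithin_iff.2 ⟨?_, ?_⟩
    · refine Tendsto.mono_left ?_ nhdsWithin_le_nhds
      rw [tendsto_pi_nhds]
      intro j
      fin_cases j
      exact tendsto_id
    · filter_upwards [self_mem_nhdsWithin] with t ht j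
      fin_cases j
      exact ht
  refine (h.comp ht).congr' ?_
  filter_upwards [(hF.eventually_toFun hB hne).filter_mono nhdsWithin_le_nhds] with t h1
  simp only [Function.comp_apply, sum_finset_fin_one, applyFam_empty, applyFam_singleton]
  simp [h1, pullEval, Complex.real_smul]
  ring

lemma HasKDeriv.tendsto_two (hB : IsOpen B) (hne : B.Nonempty) {L : (Fin 2 → ℂ → ℂ) → ℂ}
    (hL : HasKDeriv E X f φ ((↑) '' B) (isDomain_image hB hne) 2 L)
    {F G : ℝ → ℂ → ℂ} {k l : ℂ → ℂ} (hF : NearId B F k) (hG : NearId B G l)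
    (hk : DifferentiableOn ℂ k B) (hl : DifferentiableOn ℂ l B)
    {a b : ℝ → ℝ} {𝓕 : Filter ℝ} (ha : Tendsto a 𝓕 (𝓝[≠] 0)) (hb : Tendsto b 𝓕 (𝓝[≠] 0)) :
    Tendsto (fun t : ℝ => ((a t : ℂ) * b t)⁻¹ *
      (pullEval f φ (F (a t) ∘ G (b t)) - pullEval f φ (F (a t)) - pullEval f φ (G (b t)) + f φ))
      𝓕 (𝓝 (L ![k, l])) := by
  have h := hL.2 _ ![k, l]
    (fun j => by
      fin_cases j
      exacts [mem_HVFset_image hk, mem_HVFset_image hl])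
    (familyOK_planarMap X hB hne (F := ![F, G]) (k := ![k, l])
      (fun j => by
        fin_cases j
        exacts [hF, hG]))
  have ht : Tendsto (fun t : ℝ => (![a t, b t] : Fin 2 → ℝ)) 𝓕
      (𝓝[{t : Fin 2 → ℝ | ∀ j, t j ≠ 0}] 0) := by
    rw [tendsto_nhdsWithin_iff] at ha hb
    refine tendsto_nhdsWithin_iff.2 ⟨?_, ?_⟩
    · rw [tendsto_pi_nhds]
      intro j
      fin_cases j
      exacts [ha.1, hb.1]
    · filter_upwards [ha.2, hb.2] with t h1 h2 j
      fin_cases j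
      exacts [h1, h2]
  refine (h.comp ht).congr' ?_
  filter_upwards [ha.eventually ((hF.eventually_toFun hB hne).filter_mono nhdsWithin_le_nhds),
    hb.eventually ((hG.eventually_toFun hB hne).filter_mono nhdsWithin_le_nhds)] with t h1 h2
  simp only [Function.comp_apply, sum_finset_fin_two, applyFam_empty, applyFam_singleton,
    applyFam_pair]
  simp [h1, h2, pullEval, Complex.real_smul, OnePoint.map_comp]
  ring

end Differences

section Main

variable {E : Set RS} {B U W : Set ℂ} {C δ : ℝ} {h h' : ℂ → ℂ} {f : (E → RS) → ℂ} {φ : E → RS}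
  {X : ExhChoice}

lemma HasKDeriv.commutator (hU : IsOpen U) (hB : IsOpen B) (hne : B.Nonempty)
    (hBU : ∀ z ∈ B, Metric.closedBall z δ ⊆ U)
    (hUW : ∀ z ∈ U, Metric.closedBall z δ ⊆ W) (hδ : 0 < δ) (hC : 0 ≤ C)
    (hh : FieldBound W C h) (hh' : FieldBound W C h')
    (hdh : FieldBound W C (deriv h)) (hdh' : FieldBound W C (deriv h'))
    (hφ : ∀ x, φ x ∈ ((↑) '' B : Set RS))
    {L₁ : (Fin 1 → ℂ → ℂ) → ℂ} {L₂ : (Fin 2 → ℂ → ℂ) → ℂ}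
    (hL₁ : HasKDeriv E X f φ ((↑) '' B) (isDomain_image hB hne) 1 L₁)
    (hL₂ : HasKDeriv E X f φ ((↑) '' B) (isDomain_image hB hne) 2 L₂) :
    L₂ ![h', h] - L₂ ![h, h'] = L₁ ![lieField h h'] := by
  have hBs : B ⊆ U := fun z hz => hBU z hz (Metric.mem_closedBall_self hδ.le)
  have hUs : U ⊆ W := fun z hz => hUW z hz (Metric.mem_closedBall_self hδ.le)
  have hBW := hBs.trans hUs
  have dh : DifferentiableOn ℂ h B := fun z hz => (hh.diff z (hBW hz)).differentiableWithinAt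
  have dh' : DifferentiableOn ℂ h' B := fun z hz => (hh'.diff z (hBW hz)).differentiableWithinAt
  have dk : DifferentiableOn ℂ (lieField h h') B := fun z hz =>
    ((lieField_fieldBound hC hh hh' hdh hdh').diff z (hBW hz)).differentiableWithinAt
  have nh := nearId_eulerStep (hh.mono_set hBW)
  have nh' := nearId_eulerStep (hh'.mono_set hBW)
  have nw := nearId_eulerTwo (fun z hz => (hBU z hz).trans hUs) hδ hC hh hh'
  have nk := nearId_commFamily hU hB hBU hUW hδ hC hh hh' hdh hdh'
  have t1 : Tendsto (fun t : ℝ => t) (𝓝[>] 0) (𝓝[≠] 0) :=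
    tendsto_id.mono_left (nhdsWithin_mono _ fun t (ht : 0 < t) => ht.ne')
  have t2 : Tendsto (fun t : ℝ => t ^ 2) (𝓝[>] 0) (𝓝[≠] 0) := by
    refine tendsto_nhdsWithin_iff.2 ⟨?_, ?_⟩
    · have : Tendsto (fun t : ℝ => t ^ 2) (𝓝 0) (𝓝 (0 ^ 2)) := (continuous_pow 2).tendsto 0
      rw [zero_pow two_ne_zero] at this
      exact this.mono_left nhdsWithin_le_nhds
    · filter_upwards [self_mem_nhdsWithin] with t (ht : 0 < t)
      exact (pow_pos ht 2).ne'
  have l1 := hL₂.tendsto_two hB hne nh' nh dh' dh t1 t1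
  have l2 := hL₂.tendsto_two hB hne nh nh' dh dh' t1 t1
  have l3 := hL₂.tendsto_two hB hne nk nw dk (dh.add dh') t2 t1
  have l4 := (hL₁.tendsto_one hB hne nk dk).comp t2
  have l0 : Tendsto (fun t : ℝ => (t : ℂ)) (𝓝[>] 0) (𝓝 0) := by
    have := Complex.continuous_ofReal.tendsto 0
    rw [Complex.ofReal_zero] at this
    exact this.mono_left nhdsWithin_le_nhds
  have hlim := (l0.mul l3).add l4
  rw [zero_mul, zero_add] at hlim
  refine tendsto_nhds_unique (l1.sub l2) (hlim.congr' ?_)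
  filter_upwards [self_mem_nhdsWithin,
    (eventually_abs_mul_le C hδ).filter_mono nhdsWithin_le_nhds,
    (eventually_abs_mul_le C (ε := 1 / 8) (by norm_num)).filter_mono nhdsWithin_le_nhds]
    with t (ht : 0 < t) hs hs'
  have hinj : InjOn (eulerTwo h h' t) U := injOn_of_norm_sub_le fun x hx y hy =>
    eulerTwo_norm_sub_le hUW hδ hh hh' hs hs' hx hy
  have hcomp : pullEval f φ (commFamily U h h' (t ^ 2) ∘ eulerTwo h h' t) =
      pullEval f φ (eulerStep h' t ∘ eulerStep h t) := by
    refine pullEval_congr f hφ fun z hz => ?_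
    rw [commFamily, if_pos (pow_pos ht 2), Real.sqrt_sq ht.le]
    exact commMap_apply hinj (hBs hz)
  have ht0 : (t : ℂ) ≠ 0 := by exact_mod_cast ht.ne'
  rw [hcomp, show eulerStep h t ∘ eulerStep h' t = eulerTwo h h' t from rfl, Function.comp_apply,
    Complex.ofReal_pow]
  field_simp
  ring

lemma exists_plane_compact (hE : IsAnnular E) {φ : E → RS} (hφ : φ ∈ OmegaS E) :
    ∃ K : Set ℂ, IsCompact K ∧ K.Nonempty ∧ (↑) '' K = range φ := by
  obtain ⟨g, hEg, hsense, hg⟩ := hφ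
  have hrange : range φ = g.toFun '' E := by
    ext p
    simp [hg]
  have hcpt : IsCompact (range φ) := by
    rw [hrange]
    exact hE.compact.image_of_continuousOn fun p hp =>
      (g.holo p (hEg hp)).1.continuousWithinAt
  have himg : (↑) '' ((↑) ⁻¹' range φ : Set ℂ) = range φ := by
    rw [image_preimage_eq_iff]
    intro p hp
    have hne : p ≠ OnePoint.infty := by
      rintro rfl
      exact hsense.2.1 (hrange ▸ hp)
    exact OnePoint.ne_infty_iff_exists.1 hne
  refine ⟨(↑) ⁻¹' range φ, ?_, ?_, himg⟩
  · rw [OnePoint.isOpenEmbedding_coe.isInducing.isCompact_iff, himg]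
    exact hcpt
  · rw [← image_nonempty, himg, hrange]
    exact hE.connected.nonempty.image _

end Main

end CFT

open CFT Set in
/-- Lemma 2.17 of the paper: conformal derivatives represent the Lie
algebra of vector fields: for `f` twice differentiable at `Σ`, and `h, h'` holomorphic
vector fields on a domain `A ⊃ γ(Σ)`,
`∇_h ∇_{h'} f(Σ) − ∇_{h'} ∇_h f(Σ) = ∇_{h ∂h' − h' ∂h} f(Σ)`. -/
theorem conformal_derivative_commutator
    (E : Set RS) (hE : IsAnnular E) (X : ExhChoice)
    (D : (ℂ → ℂ) → ((E → RS) → ℂ) → (E → RS) → ℂ) (hD : IsNablaOp E X D)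
    (N : Set (E → RS)) (hN : ConfOpen E X N)
    (f : (E → RS) → ℂ) (φ : E → RS) (hφ : φ ∈ N)
    (hf : KTimesDiffAt E X f 2 φ)
    (A : Set RS) (hA : IsDomain A) (hsub : Set.range φ ⊆ A)
    (h h' : ℂ → ℂ) (hh : h ∈ HVFset A) (hh' : h' ∈ HVFset A) :
    D h (D h' f) φ - D h' (D h f) φ =
      D (fun z => h z * deriv h' z - h' z * deriv h z) f φ := by
  obtain ⟨K, hK, hKne, hKφ⟩ := exists_plane_compact hE (hN.1 hφ)
  have hV : IsOpen (finitePart A) := hA.1.preimage OnePoint.continuous_coe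
  have hKV : K ⊆ finitePart A := fun z hz => hsub (hKφ ▸ mem_image_of_mem _ hz)
  obtain ⟨r, hr, hrV⟩ := hK.exists_cthickening_subset_open hV hKV
  obtain ⟨δ, hδ, rfl⟩ : ∃ δ : ℝ, 0 < δ ∧ δ + (δ + δ) = r := ⟨r / 3, by positivity, by ring⟩
  set W := Metric.cthickening (δ + (δ + δ)) K
  have hW : IsCompact W := hK.cthickening
  obtain ⟨C₁, hC₁⟩ := exists_fieldBound hV hW hrV hh.1
  obtain ⟨C₂, hC₂⟩ := exists_fieldBound hV hW hrV hh'.1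
  obtain ⟨C₃, hC₃⟩ := exists_fieldBound hV hW hrV (hh.1.deriv hV)
  obtain ⟨C₄, hC₄⟩ := exists_fieldBound hV hW hrV (hh'.1.deriv hV)
  have hball : ∀ a : ℝ, ∀ z ∈ Metric.thickening a K,
      Metric.closedBall z δ ⊆ Metric.thickening (δ + a) K := by
    intro a z hz y hy
    obtain ⟨x, hx, hxz⟩ := Metric.mem_thickening_iff.1 hz
    refine Metric.mem_thickening_iff.2 ⟨x, hx, (dist_triangle y z x).trans_lt ?_⟩
    exact add_lt_add_of_le_of_lt hy hxz
  have hKB : K ⊆ Metric.thickening δ K := Metric.self_subset_thickening hδ K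
  have hB : IsOpen (Metric.thickening δ K) := Metric.isOpen_thickening
  have hne : (Metric.thickening δ K).Nonempty := hKne.mono hKB
  have hBφ : range φ ⊆ ((↑) '' Metric.thickening δ K : Set RS) := hKφ ▸ image_mono hKB
  have hBV : Metric.thickening δ K ⊆ finitePart A :=
    ((Metric.thickening_mono (by linarith) K).trans (Metric.thickening_subset_cthickening _ K)).trans
      hrV
  obtain ⟨⟨L₂, hL₂⟩, hnear⟩ := hf _ (isDomain_image hB hne) hBφ
  obtain ⟨M, -, hφM, -, hM⟩ := hnear le_rfl
  obtain ⟨⟨L₁, hL₁⟩, -⟩ := hM φ hφM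
  have key := HasKDeriv.commutator (C := max (max C₁ C₂) (max C₃ C₄)) Metric.isOpen_thickening hB hne
    (hball δ)
    (fun z hz => (hball (δ + δ) z hz).trans (Metric.thickening_subset_cthickening _ K)) hδ
    (((norm_nonneg _).trans (hC₁.bound _ (hKne.mono (Metric.self_subset_cthickening K)).some_mem)).trans
      ((le_max_left _ _).trans (le_max_left _ _)))
    (hC₁.mono ((le_max_left _ _).trans (le_max_left _ _)))
    (hC₂.mono ((le_max_right _ _).trans (le_max_left _ _)))
    (hC₃.mono ((le_max_left _ _).trans (le_max_right _ _)))
    (hC₄.mono ((le_max_right _ _).trans (le_max_right _ _)))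
    (fun x => hBφ (mem_range_self x)) hL₁ hL₂
  have mh := mem_HVFset_image (hh.1.mono hBV)
  have mh' := mem_HVFset_image (hh'.1.mono hBV)
  have mk : lieField h h' ∈ HVFset ((↑) '' Metric.thickening δ K : Set RS) := mem_HVFset_image
    (((hh.1.mul (hh'.1.deriv hV)).sub (hh'.1.mul (hh.1.deriv hV))).mono hBV)
  have e1 : D h (D h' f) φ = L₂ ![h', h] := hD f φ _ _ 2 L₂ ![h', h] two_pos
    (fun i => by
      fin_cases i
      exacts [mh', mh]) hL₂
  have e2 : D h' (D h f) φ = L₂ ![h, h'] := hD f φ _ _ 2 L₂ ![h, h'] two_pos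
    (fun i => by
      fin_cases i
      exacts [mh, mh']) hL₂
  have e3 : D (lieField h h') f φ = L₁ ![lieField h h'] :=
    hD f φ _ _ 1 L₁ ![lieField h h'] one_pos
      (fun i => by
        fin_cases i
        exact mk) hL₁
  rw [e1, e2, key, ← e3]
  rfl
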